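/- Let t > 1, λ > 0, and let P be a finite set of points in ℝ² with pairwise distinct interpoint distances that is λ-bridged. Let E be the greedy t-spanner edge set on P, characterized by: for all distinct u, v ∈ P, (u,v) ∈ E if and only if there is no t-path from u to v in the edge set E_{<|uv|} = {(x,y) ∈ E : |xy| < |uv|}. Then every edge (u,v) ∈ E satisfies |uv| ≤ λ. -/

import Mathlib

/-- Euclidean distance between two points of the plane `ℝ × ℝ`. -/
noncomputable def ed (p q : ℝ × ℝ) : ℝ :=
  Real.sqrt ((p.1 - q.1) ^ 2 + (p.2 - q.2) ^ 2)

/-- The pair `(u, v)` has a `t`-path in the Euclidean graph `(P, E)`. -/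
def HasTPath (P : Set (ℝ × ℝ)) (E : Set ((ℝ × ℝ) × (ℝ × ℝ))) (t : ℝ) (u v : ℝ × ℝ) :
    Prop :=
  ∃ (k : ℕ) (w : Fin (k + 1) → ℝ × ℝ),
    w 0 = u ∧ w (Fin.last k) = v ∧ (∀ i, w i ∈ P) ∧
    (∀ i : Fin k, (w i.castSucc, w i.succ) ∈ E) ∧
    ∑ i : Fin k, ed (w i.castSucc) (w i.succ) ≤ t * ed u v

/-- `(p, q)` bridges `(a, b)`: `t·|ap| + |pq| + t·|qb| ≤ t·|ab|`. -/
def Bridges (t : ℝ) (p q a b : ℝ × ℝ) : Prop :=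
  t * ed a p + ed p q + t * ed q b ≤ t * ed a b

/-- `(p, q)` is mandatory for `P`: the closed ellipse with foci `p, q` and
eccentricity `1/t` contains no point of `P` other than `p` and `q`. -/
def Mandatory (P : Set (ℝ × ℝ)) (t : ℝ) (p q : ℝ × ℝ) : Prop :=
  ∀ c ∈ P, ed p c + ed c q ≤ t * ed p q → c = p ∨ c = q

/-- `P` is `λ`-bridged: every pair of points of `P` at distance more than `λ` is
bridged by some mandatory pair of points of `P`. -/
def IsBridged (P : Set (ℝ × ℝ)) (t lam : ℝ) : Prop :=
  ∀ a ∈ P, ∀ b ∈ P, lam < ed a b →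
    ∃ p ∈ P, ∃ q ∈ P, p ≠ q ∧ p ≠ a ∧ p ≠ b ∧ q ≠ a ∧ q ≠ b ∧
      Mandatory P t p q ∧ Bridges t p q a b

theorem ed_eq_dist (p q : ℝ × ℝ) :
    ed p q = dist (⟨p.1, p.2⟩ : ℂ) ⟨q.1, q.2⟩ := by
  rw [Complex.dist_eq_re_im, ed]

theorem ed_self (p : ℝ × ℝ) : ed p p = 0 := by simp [ed]

theorem ed_comm (p q : ℝ × ℝ) : ed p q = ed q p := by
  simp only [ed_eq_dist, dist_comm]

theorem ed_triangle (p q r : ℝ × ℝ) : ed p r ≤ ed p q + ed q r := by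
  simp only [ed_eq_dist]
  exact dist_triangle _ _ _

theorem ed_nonneg (p q : ℝ × ℝ) : 0 ≤ ed p q := Real.sqrt_nonneg _

theorem ed_pos {p q : ℝ × ℝ} (h : p ≠ q) : 0 < ed p q := by
  rw [ed_eq_dist, dist_pos]
  intro h'
  rw [Complex.mk.injEq] at h'
  exact h (Prod.ext h'.1 h'.2)

/-- There is a walk from `u` to `v` of total length `L` through points of `P` along pairs
of `F`. -/
inductive WalkOfLength (P : Set (ℝ × ℝ)) (F : Set ((ℝ × ℝ) × (ℝ × ℝ))) :
    ℝ × ℝ → ℝ × ℝ → ℝ → Prop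
  | nil {u : ℝ × ℝ} (hu : u ∈ P) : WalkOfLength P F u u 0
  | cons {u c v : ℝ × ℝ} {L : ℝ} (hu : u ∈ P) (huc : (u, c) ∈ F)
      (h : WalkOfLength P F c v L) : WalkOfLength P F u v (ed u c + L)

namespace WalkOfLength

variable {P : Set (ℝ × ℝ)} {F G : Set ((ℝ × ℝ) × (ℝ × ℝ))} {u c v : ℝ × ℝ} {L M : ℝ}

theorem start_mem (h : WalkOfLength P F u v L) : u ∈ P := by
  cases h <;> assumption

theorem ed_le (h : WalkOfLength P F u v L) : ed u v ≤ L := by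
  induction h with
  | nil => simp [ed_self]
  | @cons u c v L _ _ _ ih => linarith [ed_triangle u c v]

theorem append (h : WalkOfLength P F u c L) (h' : WalkOfLength P F c v M) :
    WalkOfLength P F u v (L + M) := by
  induction h with
  | nil => simpa using h'
  | cons hu huc _ ih =>
    rw [add_assoc]
    exact cons hu huc (ih h')

theorem mono (hFG : F ⊆ G) (h : WalkOfLength P F u v L) : WalkOfLength P G u v L := by
  induction h with
  | nil hu => exact nil hu
  | cons hu huc _ ih => exact cons hu (hFG huc) ih

theorem single (hu : u ∈ P) (hv : v ∈ P) (h : (u, v) ∈ F) :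
    WalkOfLength P F u v (ed u v) := by
  simpa using cons hu h (nil hv)

theorem of_fin (k : ℕ) (w : Fin (k + 1) → ℝ × ℝ) (hP : ∀ i, w i ∈ P)
    (hF : ∀ i : Fin k, (w i.castSucc, w i.succ) ∈ F) :
    WalkOfLength P F (w 0) (w (Fin.last k)) (∑ i : Fin k, ed (w i.castSucc) (w i.succ)) := by
  induction k with
  | zero => simpa using nil (hP 0)
  | succ k ih =>
    rw [Fin.sum_univ_succ]
    exact cons (hP 0) (hF 0) (ih (fun i => w i.succ) (fun i => hP _) fun i => hF i.succ)

theorem exists_fin (h : WalkOfLength P F u v L) :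
    ∃ (k : ℕ) (w : Fin (k + 1) → ℝ × ℝ),
      w 0 = u ∧ w (Fin.last k) = v ∧ (∀ i, w i ∈ P) ∧
      (∀ i : Fin k, (w i.castSucc, w i.succ) ∈ F) ∧
      ∑ i : Fin k, ed (w i.castSucc) (w i.succ) = L := by
  induction h with
  | @nil u hu => exact ⟨0, fun _ => u, rfl, rfl, fun _ => hu, fun i => i.elim0, by simp⟩
  | @cons u c v L hu huc _ ih =>
    obtain ⟨k, w, h0, hlast, hP, hF, hL⟩ := ih
    refine ⟨k + 1, Fin.cons u w, rfl, ?_, ?_, ?_, ?_⟩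
    · rw [← Fin.succ_last, Fin.cons_succ, hlast]
    · exact Fin.cases hu hP
    · refine Fin.cases ?_ fun i => ?_
      · simpa [h0] using huc
      · simpa [← Fin.succ_castSucc] using hF i
    · rw [Fin.sum_univ_succ, ← hL]
      simp [h0]

end WalkOfLength

theorem hasTPath_iff_exists_walk {P : Set (ℝ × ℝ)} {F : Set ((ℝ × ℝ) × (ℝ × ℝ))} {t : ℝ}
    {u v : ℝ × ℝ} : HasTPath P F t u v ↔ ∃ L ≤ t * ed u v, WalkOfLength P F u v L := by
  constructor
  · rintro ⟨k, w, rfl, rfl, hP, hF, hL⟩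
    exact ⟨_, hL, .of_fin k w hP hF⟩
  · rintro ⟨L, hL, h⟩
    obtain ⟨k, w, h0, hlast, hP, hF, rfl⟩ := h.exists_fin
    exact ⟨k, w, h0, hlast, hP, hF, hL⟩

/-- A mandatory pair has no `t`-path consisting of strictly shorter pairs. -/
theorem Mandatory.not_hasTPath {P : Set (ℝ × ℝ)} {F : Set ((ℝ × ℝ) × (ℝ × ℝ))} {t : ℝ}
    {p q : ℝ × ℝ} (h : Mandatory P t p q) (hpq : p ≠ q) (hF : ∀ e ∈ F, e.1 ≠ e.2)
    (hlt : ∀ e ∈ F, ed e.1 e.2 < ed p q) : ¬ HasTPath P F t p q := by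
  rw [hasTPath_iff_exists_walk]
  rintro ⟨L, hL, hw⟩
  cases hw with
  | nil => exact hpq rfl
  | @cons _ c _ L _ hpc hw =>
    rcases h c hw.start_mem (by linarith [hw.ed_le]) with rfl | rfl
    · exact hF _ hpc rfl
    · exact lt_irrefl _ (hlt _ hpc)

/-- A mandatory pair bridging `(a, b)` is strictly shorter than `(a, b)`. -/
theorem Mandatory.ed_lt_of_bridges {P : Set (ℝ × ℝ)} {t : ℝ} {p q a b : ℝ × ℝ}
    (h : Mandatory P t p q) (ht : 1 < t) (ha : a ∈ P) (hpa : p ≠ a) (hqa : q ≠ a)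
    (hpq : p ≠ q) (hb : Bridges t p q a b) : ed p q < ed a b := by
  have hell : t * ed p q < ed p a + ed a q := by
    by_contra! hle
    rcases h a ha hle with rfl | rfl
    · exact hpa rfl
    · exact hqa rfl
  have htri := ed_triangle a b q
  rw [ed_comm p a] at hell
  rw [ed_comm b q] at htri
  unfold Bridges at hb
  have hpos := ed_pos hpq
  have h1 : t * (t * ed p q) < t * (ed a p + (ed a b + ed q b)) :=
    mul_lt_mul_of_pos_left (by linarith) (by linarith)
  have h2 : 0 ≤ (t - 1) ^ 2 * ed p q := by positivity
  nlinarith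

/-- Lemma `greedyshortedges`: if a finite point set `P` with
pairwise distinct interpoint distances is `λ`-bridged, then every edge of the greedy
`t`-spanner on `P` — the edge set `E` such that for distinct `u, v ∈ P`,
`(u,v) ∈ E` iff there is no `t`-path from `u` to `v` among the strictly shorter edges
of `E` — has length at most `λ`. -/
theorem greedy_spanner_short_edges (t lam : ℝ) (ht : 1 < t) (hlam : 0 < lam)
    (P : Finset (ℝ × ℝ))
    (hdist : ∀ u ∈ P, ∀ v ∈ P, ∀ x ∈ P, ∀ y ∈ P, u ≠ v → x ≠ y →
      ed u v = ed x y → (u = x ∧ v = y) ∨ (u = y ∧ v = x))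
    (hbr : IsBridged (↑P) t lam)
    (E : Set ((ℝ × ℝ) × (ℝ × ℝ)))
    (hEP : ∀ e ∈ E, e.1 ∈ P ∧ e.2 ∈ P ∧ e.1 ≠ e.2)
    (hgreedy : ∀ u ∈ P, ∀ v ∈ P, u ≠ v →
      ((u, v) ∈ E ↔ ¬ HasTPath (↑P) {e ∈ E | ed e.1 e.2 < ed u v} t u v)) :
    ∀ e ∈ E, ed e.1 e.2 ≤ lam := by
  rintro ⟨a, b⟩ hab
  by_contra! hlt
  obtain ⟨ha, hb, hne⟩ := hEP _ hab
  dsimp only at ha hb hne hlt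
  obtain ⟨p, hp, q, hq, hpq, hpa, hpb, hqa, hqb, hmand, hbridge⟩ := hbr a ha b hb hlt
  have short : ∀ u ∈ P, ∀ v ∈ P, u ≠ v → ed u v < ed a b →
      ∃ L ≤ t * ed u v, WalkOfLength P {e ∈ E | ed e.1 e.2 < ed a b} u v L := by
    intro u hu v hv huv huvab
    by_cases hE : (u, v) ∈ E
    · exact ⟨_, le_mul_of_one_le_left (ed_nonneg u v) ht.le, .single hu hv ⟨hE, huvab⟩⟩
    · rw [hgreedy u hu v hv huv, not_not, hasTPath_iff_exists_walk] at hE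
      obtain ⟨L, hL, hw⟩ := hE
      exact ⟨L, hL, hw.mono fun e he => ⟨he.1, he.2.trans huvab⟩⟩
  have hpqE : (p, q) ∈ E := (hgreedy p hp q hq hpq).2 <|
    hmand.not_hasTPath hpq (fun e he => (hEP e he.1).2.2) fun e he => he.2
  have hpqlt := hmand.ed_lt_of_bridges ht ha hpa hqa hpq hbridge
  unfold Bridges at hbridge
  have ht0 : 0 < t := by linarith
  have hpos := ed_pos hpq
  have hap : ed a p < ed a b :=
    lt_of_mul_lt_mul_left (by linarith [mul_nonneg ht0.le (ed_nonneg q b)]) ht0.le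
  have hqb' : ed q b < ed a b :=
    lt_of_mul_lt_mul_left (by linarith [mul_nonneg ht0.le (ed_nonneg a p)]) ht0.le
  obtain ⟨L, hL, hw⟩ := short a ha p hp hpa.symm hap
  obtain ⟨M, hM, hw'⟩ := short q hq b hb hqb hqb'
  exact (hgreedy a ha b hb hne).1 hab <| hasTPath_iff_exists_walk.2
    ⟨_, by linarith, hw.append (.cons hp ⟨hpqE, hpqlt⟩ hw')⟩
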